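/- arXiv:2506.14031 — 7 statements merged into one kernel-verified Lean document; each statement's English description precedes it below -/
import Mathlib

section
/- Each of the following holds: (a) the map s ↦ X(s) from ℝ^14 to 𝔤𝔩(7,ℝ) is linear and injective, so 𝔤₂* is a 14-dimensional linear subspace of 𝔤𝔩(7,ℝ); (b) 𝔤₂* is closed under the matrix commutator, i.e. for all s,t ∈ ℝ^14 the matrix X(s)X(t) − X(t)X(s) lies in 𝔤₂*; (c) every X ∈ 𝔤₂* is skew-adjoint with respect to ⟨·,·⟩, i.e. ⟨Xu,v⟩ + ⟨u,Xv⟩ = 0 for all u,v ∈ ℝ^7; (d) every X ∈ 𝔤₂* annihilates ω₀, i.e. ω₀(Xu,v,w) + ω₀(u,Xv,w) + ω₀(u,v,Xw) = 0 for all u,v,w ∈ ℝ^7. -/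
open Matrix

noncomputable section

abbrev V7 : Type := Fin 7 → ℝ
abbrev M7 : Type := Matrix (Fin 7) (Fin 7) ℝ
abbrev M2 : Type := Matrix (Fin 2) (Fin 2) ℝ

/-- The standard basis of `ℝ^7` (0-indexed: `e 0` is `e_1` of the paper). -/
def e (i : Fin 7) : V7 := Pi.single i 1

/-- The symmetric bilinear form of signature (4,3):
`⟨e_1,e_5⟩ = ⟨e_2,e_6⟩ = ⟨e_3,e_7⟩ = 1`, `⟨e_4,e_4⟩ = −1`. -/
def ip (u v : V7) : ℝ :=
  u 0 * v 4 + u 4 * v 0 + u 1 * v 5 + u 5 * v 1 + u 2 * v 6 + u 6 * v 2 - u 3 * v 3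

/-- 3×3 determinant. -/
def det3 (a b c d e f g h i : ℝ) : ℝ :=
  a * (e * i - f * h) - b * (d * i - f * g) + c * (d * h - e * g)

/-- `(e^i ∧ e^j ∧ e^k)(u,v,w)` for 0-indexed `i j k`. -/
def tri (i j k : Fin 7) (u v w : V7) : ℝ :=
  det3 (u i) (u j) (u k) (v i) (v j) (v k) (w i) (w j) (w k)

/-- The standard generic 3-form
`ω₀ = √2(e^{167}+e^{235}) − e^4∧(e^{15}−e^{26}−e^{37})`. -/
def om0 (u v w : V7) : ℝ :=
  Real.sqrt 2 * (tri 0 5 6 u v w + tri 1 2 4 u v w)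
    - tri 3 0 4 u v w + tri 3 1 5 u v w + tri 3 2 6 u v w

/-- The matrix `X(s)` (indices shifted: `s 0 = s_1`, …, `s 13 = s_14`). -/
def Xg2 (s : Fin 14 → ℝ) : M7 :=
  !![s 0 + s 3, -s 9, s 8, Real.sqrt 2 * s 5, 0, -s 10, -s 11;
     -s 7, s 0, s 1, Real.sqrt 2 * s 8, s 10, 0, s 5;
     s 6, s 2, s 3, Real.sqrt 2 * s 9, s 11, -s 5, 0;
     Real.sqrt 2 * s 4, Real.sqrt 2 * s 6, Real.sqrt 2 * s 7, 0,
       Real.sqrt 2 * s 5, Real.sqrt 2 * s 8, Real.sqrt 2 * s 9;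
     0, s 12, s 13, Real.sqrt 2 * s 4, -s 0 - s 3, s 7, -s 6;
     -s 12, 0, -s 4, Real.sqrt 2 * s 6, s 9, -s 0, -s 2;
     -s 13, s 4, 0, Real.sqrt 2 * s 7, -s 8, -s 1, -s 3]

/-- `𝔤₂* = {X(s) : s ∈ ℝ^14}`. -/
def g2star : Set M7 := Set.range Xg2

/-- Reads off the parameters of a matrix of the form `Xg2 s`. -/
def g2Coord (M : M7) : Fin 14 → ℝ :=
  ![M 1 1, M 1 2, M 2 1, M 2 2, M 6 1, M 1 6, M 2 0, -M 1 0, M 0 2, -M 0 1, M 1 4, M 2 4,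
    M 4 1, M 4 2]

lemma g2Coord_Xg2 (s : Fin 14 → ℝ) : g2Coord (Xg2 s) = s := by
  ext i
  fin_cases i <;> simp [g2Coord, Xg2]

lemma Xg2_injective : Function.Injective Xg2 :=
  Function.LeftInverse.injective g2Coord_Xg2

lemma isLinearMap_Xg2 : IsLinearMap ℝ Xg2 where
  map_add s t := by
    ext i j
    fin_cases i <;> fin_cases j <;> simp [Xg2] <;> ring
  map_smul c s := by
    ext i j
    fin_cases i <;> fin_cases j <;> simp [Xg2] <;> ring

lemma commutator_apply (A B : M7) (i j : Fin 7) :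
    (A * B - B * A) i j =
      A i 0 * B 0 j + A i 1 * B 1 j + A i 2 * B 2 j + A i 3 * B 3 j + A i 4 * B 4 j +
          A i 5 * B 5 j + A i 6 * B 6 j -
        (B i 0 * A 0 j + B i 1 * A 1 j + B i 2 * A 2 j + B i 3 * A 3 j + B i 4 * A 4 j +
          B i 5 * A 5 j + B i 6 * A 6 j) := by
  simp only [Matrix.sub_apply, Matrix.mul_apply, Fin.sum_univ_seven]

set_option maxHeartbeats 800000 in
lemma Xg2_commutator (s t : Fin 14 → ℝ) :
    Xg2 (g2Coord (Xg2 s * Xg2 t - Xg2 t * Xg2 s)) = Xg2 s * Xg2 t - Xg2 t * Xg2 s := by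
  have h : √(2 : ℝ) ^ 2 = 2 := Real.sq_sqrt zero_le_two
  have h3 : √(2 : ℝ) ^ 3 = 2 * √2 := by rw [pow_succ, h]
  generalize hC : Xg2 s * Xg2 t - Xg2 t * Xg2 s = C
  ext i j
  fin_cases i <;> fin_cases j <;>
    simp [Xg2, g2Coord] <;>
    subst hC <;>
    simp only [commutator_apply] <;>
    simp [Xg2] <;>
    ring_nf <;>
    (try simp only [h, h3]) <;>
    ring

lemma Xg2_mulVec (s : Fin 14 → ℝ) (u : V7) :
    (Xg2 s).mulVec u =
      ![(s 0 + s 3) * u 0 - s 9 * u 1 + s 8 * u 2 + √2 * s 5 * u 3 - s 10 * u 5 - s 11 * u 6,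
        -s 7 * u 0 + s 0 * u 1 + s 1 * u 2 + √2 * s 8 * u 3 + s 10 * u 4 + s 5 * u 6,
        s 6 * u 0 + s 2 * u 1 + s 3 * u 2 + √2 * s 9 * u 3 + s 11 * u 4 - s 5 * u 5,
        √2 * (s 4 * u 0 + s 6 * u 1 + s 7 * u 2 + s 5 * u 4 + s 8 * u 5 + s 9 * u 6),
        s 12 * u 1 + s 13 * u 2 + √2 * s 4 * u 3 + (-s 0 - s 3) * u 4 + s 7 * u 5 - s 6 * u 6,
        -s 12 * u 0 - s 4 * u 2 + √2 * s 6 * u 3 + s 9 * u 4 - s 0 * u 5 - s 2 * u 6,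
        -s 13 * u 0 + s 4 * u 1 + √2 * s 7 * u 3 - s 8 * u 4 - s 1 * u 5 - s 3 * u 6] := by
  ext i
  fin_cases i <;> simp [Xg2, Matrix.mulVec, dotProduct, Fin.sum_univ_succ] <;> ring

lemma ip_Xg2_mulVec (s : Fin 14 → ℝ) (u v : V7) :
    ip ((Xg2 s).mulVec u) v + ip u ((Xg2 s).mulVec v) = 0 := by
  simp only [Xg2_mulVec, ip]
  simp
  ring

lemma om0_Xg2_mulVec (s : Fin 14 → ℝ) (u v w : V7) :
    om0 ((Xg2 s).mulVec u) v w + om0 u ((Xg2 s).mulVec v) w + om0 u v ((Xg2 s).mulVec w) = 0 := by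
  have h : √(2 : ℝ) ^ 2 = 2 := Real.sq_sqrt zero_le_two
  simp only [Xg2_mulVec, om0, tri, det3]
  simp
  ring_nf
  simp only [h]
  ring

theorem stmt0 :
    (IsLinearMap ℝ Xg2 ∧ Function.Injective Xg2 ∧
      ∃ S : Submodule ℝ M7, (S : Set M7) = g2star ∧ Module.finrank ℝ ↥S = 14) ∧
    (∀ s t : Fin 14 → ℝ, Xg2 s * Xg2 t - Xg2 t * Xg2 s ∈ g2star) ∧
    (∀ X ∈ g2star, ∀ u v : V7, ip (X.mulVec u) v + ip u (X.mulVec v) = 0) ∧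
    (∀ X ∈ g2star, ∀ u v w : V7,
      om0 (X.mulVec u) v w + om0 u (X.mulVec v) w + om0 u v (X.mulVec w) = 0) := by
  refine ⟨⟨isLinearMap_Xg2, Xg2_injective, LinearMap.range (isLinearMap_Xg2.mk' Xg2), ?_, ?_⟩,
    fun s t => ⟨_, Xg2_commutator s t⟩, ?_, ?_⟩
  · rfl
  · rw [LinearMap.finrank_range_of_inj Xg2_injective]
    simp
  · rintro _ ⟨s, rfl⟩ u v
    exact ip_Xg2_mulVec s u v
  · rintro _ ⟨s, rfl⟩ u v w
    exact om0_Xg2_mulVec s u v w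
end
end

section
/- Each of the following holds: (a) every matrix h(A,v,u,y) belongs to 𝔤₂*; (b) 𝔥^I is closed under the matrix commutator; (c) 𝔪 is an ideal of 𝔥^I, i.e. [𝔥^I, 𝔪] ⊆ 𝔪; (d) 𝔪 is nilpotent of step exactly 3, i.e. [𝔪,[𝔪,[𝔪,𝔪]]] = 0 while [𝔪,[𝔪,𝔪]] ≠ 0, where brackets denote spans of matrix commutators. -/
open Matrix

noncomputable section

/-- The matrix `h(A,v,u,y)`. -/
def hmat (A : M2) (v : ℝ) (u y : Fin 2 → ℝ) : M7 :=
  !![A 0 0 + A 1 1, -u 1, u 0, Real.sqrt 2 * v, 0, -y 0, -y 1;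
     0, A 0 0, A 0 1, Real.sqrt 2 * u 0, y 0, 0, v;
     0, A 1 0, A 1 1, Real.sqrt 2 * u 1, y 1, -v, 0;
     0, 0, 0, 0, Real.sqrt 2 * v, Real.sqrt 2 * u 0, Real.sqrt 2 * u 1;
     0, 0, 0, 0, -(A 0 0 + A 1 1), 0, 0;
     0, 0, 0, 0, u 1, -A 0 0, -A 1 0;
     0, 0, 0, 0, -u 0, -A 0 1, -A 1 1]

/-- `𝔥^I = {h(A,v,u,y)}`. -/
def hI : Set M7 := {X | ∃ A v u y, X = hmat A v u y}

/-- `𝔪 = {h(0,v,u,y)}`. -/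
def mfrak : Set M7 := {X | ∃ v u y, X = hmat 0 v u y}

/-- The span of all commutators `[X,Y]`, `X ∈ S`, `Y ∈ T`. -/
def bracketSpan (S T : Set M7) : Submodule ℝ M7 :=
  Submodule.span ℝ {Z | ∃ X ∈ S, ∃ Y ∈ T, Z = X * Y - Y * X}

theorem hmat_add (A A' : M2) (v v' : ℝ) (u u' y y' : Fin 2 → ℝ) :
    hmat A v u y + hmat A' v' u' y' = hmat (A + A') (v + v') (u + u') (y + y') := by
  ext i j
  fin_cases i <;> fin_cases j <;> simp [hmat] <;> ring

theorem smul_hmat (c : ℝ) (A : M2) (v : ℝ) (u y : Fin 2 → ℝ) :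
    c • hmat A v u y = hmat (c • A) (c * v) (c • u) (c • y) := by
  ext i j
  fin_cases i <;> fin_cases j <;> simp [hmat] <;> ring

theorem hmat_zero : hmat 0 0 0 0 = 0 := by
  ext i j
  fin_cases i <;> fin_cases j <;> simp [hmat]

theorem hmat_mem_g2star (A : M2) (v : ℝ) (u y : Fin 2 → ℝ) : hmat A v u y ∈ g2star := by
  refine ⟨![A 0 0, A 0 1, A 1 0, A 1 1, 0, v, 0, 0, u 0, u 1, y 0, y 1, 0, 0], ?_⟩
  ext i j
  fin_cases i <;> fin_cases j <;> simp [hmat, Xg2]; ring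

set_option maxHeartbeats 2000000 in
/-- The Lie bracket of two matrices `h(A,v,u,y)`, in coordinates. -/
theorem hmat_commutator (A A' : M2) (v v' : ℝ) (u u' y y' : Fin 2 → ℝ) :
    hmat A v u y * hmat A' v' u' y' - hmat A' v' u' y' * hmat A v u y =
      hmat (A * A' - A' * A)
        (A.trace * v' - A'.trace * v + 2 * (u 0 * u' 1 - u' 0 * u 1))
        (A *ᵥ u' - A' *ᵥ u)
        (A *ᵥ y' + A.trace • y' - (A' *ᵥ y + A'.trace • y) + 3 • (v' • u - v • u')) := by
  have h2 : Real.sqrt 2 ^ 2 = 2 := Real.sq_sqrt zero_le_two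
  ext i j
  rw [Matrix.sub_apply, Matrix.mul_apply, Matrix.mul_apply, Fin.sum_univ_seven,
    Fin.sum_univ_seven]
  fin_cases i <;> fin_cases j <;>
    simp [hmat, Matrix.mul_apply, Matrix.trace, Fin.sum_univ_two, Matrix.vecHead,
      Matrix.vecTail] <;>
    ring_nf <;> simp only [h2] <;> ring

/-- The subspace `{h(0,v,0,y)}`. -/
def vySubmodule : Submodule ℝ M7 where
  carrier := {X | ∃ v y, X = hmat 0 v 0 y}
  add_mem' := by
    rintro _ _ ⟨v, y, rfl⟩ ⟨v', y', rfl⟩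
    exact ⟨v + v', y + y', by simp [hmat_add]⟩
  zero_mem' := ⟨0, 0, hmat_zero.symm⟩
  smul_mem' := by
    rintro c _ ⟨v, y, rfl⟩
    exact ⟨c * v, c • y, by simp [smul_hmat]⟩

/-- The subspace `{h(0,0,0,y)}`. -/
def ySubmodule : Submodule ℝ M7 where
  carrier := {X | ∃ y, X = hmat 0 0 0 y}
  add_mem' := by
    rintro _ _ ⟨y, rfl⟩ ⟨y', rfl⟩
    exact ⟨y + y', by simp [hmat_add]⟩
  zero_mem' := ⟨0, hmat_zero.symm⟩
  smul_mem' := by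
    rintro c _ ⟨y, rfl⟩
    exact ⟨c • y, by simp [smul_hmat]⟩

theorem commutator_mem_bracketSpan {S T : Set M7} {X Y : M7} (hX : X ∈ S) (hY : Y ∈ T) :
    X * Y - Y * X ∈ bracketSpan S T :=
  Submodule.subset_span ⟨X, hX, Y, hY, rfl⟩

theorem bracketSpan_le {S T : Set M7} {N : Submodule ℝ M7}
    (h : ∀ X ∈ S, ∀ Y ∈ T, X * Y - Y * X ∈ N) : bracketSpan S T ≤ N := by
  refine Submodule.span_le.2 ?_
  rintro _ ⟨X, hX, Y, hY, rfl⟩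
  exact h X hX Y hY

theorem bracketSpan_mfrak_mfrak_le : bracketSpan mfrak mfrak ≤ vySubmodule := by
  refine bracketSpan_le ?_
  rintro _ ⟨v, u, y, rfl⟩ _ ⟨v', u', y', rfl⟩
  rw [hmat_commutator]
  exact ⟨2 * (u 0 * u' 1 - u' 0 * u 1), 3 • (v' • u - v • u'), by simp⟩

theorem bracketSpan_mfrak_bracketSpan_le :
    bracketSpan mfrak ↑(bracketSpan mfrak mfrak) ≤ ySubmodule := by
  refine bracketSpan_le ?_
  rintro _ ⟨v, u, y, rfl⟩ _ hY
  obtain ⟨v', y', rfl⟩ := bracketSpan_mfrak_mfrak_le hY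
  rw [hmat_commutator]
  exact ⟨3 • (v' • u), by simp⟩

theorem bracketSpan_mfrak_lower_central_eq_bot :
    bracketSpan mfrak ↑(bracketSpan mfrak ↑(bracketSpan mfrak mfrak)) = ⊥ := by
  rw [eq_bot_iff]
  refine bracketSpan_le ?_
  rintro _ ⟨v, u, y, rfl⟩ _ hY
  obtain ⟨y', rfl⟩ := bracketSpan_mfrak_bracketSpan_le hY
  rw [hmat_commutator, Submodule.mem_bot, ← hmat_zero]
  simp

theorem bracketSpan_mfrak_bracketSpan_ne_bot :
    bracketSpan mfrak ↑(bracketSpan mfrak mfrak) ≠ ⊥ := by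
  intro hbot
  have h₀ : hmat 0 0 ![1, 0] 0 ∈ mfrak := ⟨_, _, _, rfl⟩
  have h₁ : hmat 0 0 ![0, 1] 0 ∈ mfrak := ⟨_, _, _, rfl⟩
  have h := commutator_mem_bracketSpan h₀ (commutator_mem_bracketSpan h₀ h₁)
  rw [hbot, Submodule.mem_bot, hmat_commutator, hmat_commutator] at h
  simpa [hmat] using congrFun (congrFun h 1) 4

theorem stmt1 :
    (∀ (A : M2) (v : ℝ) (u y : Fin 2 → ℝ), hmat A v u y ∈ g2star) ∧
    (∀ X ∈ hI, ∀ Y ∈ hI, X * Y - Y * X ∈ hI) ∧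
    (∀ X ∈ hI, ∀ Y ∈ mfrak, X * Y - Y * X ∈ mfrak) ∧
    (bracketSpan mfrak
        ↑(bracketSpan mfrak ↑(bracketSpan mfrak mfrak)) = ⊥ ∧
      bracketSpan mfrak ↑(bracketSpan mfrak mfrak) ≠ ⊥) := by
  refine ⟨hmat_mem_g2star, ?_, ?_, bracketSpan_mfrak_lower_central_eq_bot,
    bracketSpan_mfrak_bracketSpan_ne_bot⟩
  · rintro _ ⟨A, v, u, y, rfl⟩ _ ⟨A', v', u', y', rfl⟩
    exact ⟨_, _, _, _, hmat_commutator A A' v v' u u' y y'⟩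
  · rintro _ ⟨A, v, u, y, rfl⟩ _ ⟨v', u', y', rfl⟩
    rw [hmat_commutator]
    exact ⟨_, _, _, by rw [mul_zero, zero_mul, sub_zero]⟩
end
end

section
/- The following commutator identities hold in 𝔤𝔩(7,ℝ): (a) [h(A,0,0,0), h(A',0,0,0)] = h(AA'−A'A, 0, 0, 0) for all A, A' ∈ 𝔤𝔩(2,ℝ); (b) [h(A,0,0,0), h(0,v,0,y)] = h(0, tr(A)v, 0, Ay + tr(A)y) for all A ∈ 𝔤𝔩(2,ℝ), v ∈ ℝ, y ∈ ℝ²; (c) [h(0,v,0,y), h(0,v',0,y')] = 0 for all v,v' ∈ ℝ, y,y' ∈ ℝ². Consequently 𝔥^III is a Lie subalgebra of 𝔤𝔩(7,ℝ), the subspace 𝔪(1,0,2) = {h(0,v,y)} is an abelian ideal of 𝔥^III, and 𝔪(1,0,1) ⊆ 𝔪(1,0,2) is an abelian subalgebra with [h(A,0,0,0), 𝔪(1,0,1)] ⊆ 𝔪(1,0,2) for all A. -/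
open Matrix

noncomputable section

/-- The matrix `h(A,v,y) := h(A,v,0,y)`. -/
def h3 (A : M2) (v : ℝ) (y : Fin 2 → ℝ) : M7 := hmat A v 0 y

/-- `𝔥^III = {h(A,v,y)}`. -/
def hIII : Set M7 := {X | ∃ A v y, X = h3 A v y}

/-- `𝔪(1,0,1) = {h(0,v,(y_1,0))}`. -/
def m101 : Set M7 := {X | ∃ v y1, X = h3 0 v ![y1, 0]}

/-- `𝔪(1,0,2) = {h(0,v,(y_1,y_2))}`. -/
def m102 : Set M7 := {X | ∃ v y, X = h3 0 v y}

lemma h3_smul_add_h3 (c : ℝ) (A A' : M2) (v v' : ℝ) (y y' : Fin 2 → ℝ) :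
    c • h3 A v y + h3 A' v' y' = h3 (c • A + A') (c * v + v') (c • y + y') := by
  ext i j
  fin_cases i <;> fin_cases j <;> simp [h3, hmat] <;> ring

lemma h3_zero : h3 0 0 0 = 0 := by
  ext i j
  fin_cases i <;> fin_cases j <;> simp [h3, hmat]

set_option maxHeartbeats 1000000 in
lemma h3_commutator (A A' : M2) (v v' : ℝ) (y y' : Fin 2 → ℝ) :
    h3 A v y * h3 A' v' y' - h3 A' v' y' * h3 A v y =
      h3 (A * A' - A' * A) (A.trace * v' - A'.trace * v)
        (A *ᵥ y' + A.trace • y' - (A' *ᵥ y + A'.trace • y)) := by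
  ext i j
  rw [Matrix.sub_apply, Matrix.mul_apply, Matrix.mul_apply, Fin.sum_univ_seven,
    Fin.sum_univ_seven]
  fin_cases i <;> fin_cases j <;>
    simp [h3, hmat, Matrix.mul_apply, Matrix.trace_fin_two, Matrix.vecHead,
      Matrix.vecTail] <;> ring

/-- `𝔥^III` as a linear subspace of `𝔤𝔩(7,ℝ)`. -/
def hIIISubmodule : Submodule ℝ M7 where
  carrier := hIII
  add_mem' := by
    rintro _ _ ⟨A, v, y, rfl⟩ ⟨A', v', y', rfl⟩
    exact ⟨_, _, _, by simpa using h3_smul_add_h3 1 A A' v v' y y'⟩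
  zero_mem' := ⟨0, 0, 0, h3_zero.symm⟩
  smul_mem' := by
    rintro c _ ⟨A, v, y, rfl⟩
    exact ⟨_, _, _, by simpa [h3_zero] using h3_smul_add_h3 c A 0 v 0 y 0⟩

lemma h3_zero_commutator (v v' : ℝ) (y y' : Fin 2 → ℝ) :
    h3 0 v y * h3 0 v' y' - h3 0 v' y' * h3 0 v y = 0 := by
  simp [h3_commutator, h3_zero]

lemma commutator_mem_m102 {X Y : M7} (hX : X ∈ hIII) (hY : Y ∈ m102) :
    X * Y - Y * X ∈ m102 := by
  obtain ⟨A, v, y, rfl⟩ := hX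
  obtain ⟨v', y', rfl⟩ := hY
  exact ⟨_, _, by rw [h3_commutator, mul_zero, zero_mul, sub_zero]⟩

lemma commutator_eq_zero_of_mem_m102 {X Y : M7} (hX : X ∈ m102) (hY : Y ∈ m102) :
    X * Y - Y * X = 0 := by
  obtain ⟨v, y, rfl⟩ := hX
  obtain ⟨v', y', rfl⟩ := hY
  exact h3_zero_commutator v v' y y'

lemma m101_subset_m102 : m101 ⊆ m102 := by
  rintro _ ⟨v, y, rfl⟩
  exact ⟨v, _, rfl⟩

theorem stmt2 :
    (∀ A A' : M2, hmat A 0 0 0 * hmat A' 0 0 0 - hmat A' 0 0 0 * hmat A 0 0 0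
      = hmat (A * A' - A' * A) 0 0 0) ∧
    (∀ (A : M2) (v : ℝ) (y : Fin 2 → ℝ),
      hmat A 0 0 0 * h3 0 v y - h3 0 v y * hmat A 0 0 0
        = h3 0 ((A 0 0 + A 1 1) * v) (A.mulVec y + (A 0 0 + A 1 1) • y)) ∧
    (∀ (v v' : ℝ) (y y' : Fin 2 → ℝ),
      h3 0 v y * h3 0 v' y' - h3 0 v' y' * h3 0 v y = 0) ∧
    (∃ S : Submodule ℝ M7, (S : Set M7) = hIII) ∧
    (∀ X ∈ hIII, ∀ Y ∈ hIII, X * Y - Y * X ∈ hIII) ∧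
    m102 ⊆ hIII ∧
    (∀ X ∈ hIII, ∀ Y ∈ m102, X * Y - Y * X ∈ m102) ∧
    (∀ X ∈ m102, ∀ Y ∈ m102, X * Y - Y * X = 0) ∧
    m101 ⊆ m102 ∧
    (∀ X ∈ m101, ∀ Y ∈ m101, X * Y - Y * X = 0) ∧
    (∀ A : M2, ∀ Y ∈ m101, hmat A 0 0 0 * Y - Y * hmat A 0 0 0 ∈ m102) := by
  refine ⟨fun A A' => ?_, fun A v y => ?_, h3_zero_commutator, ⟨hIIISubmodule, rfl⟩, ?_, ?_,
    fun X hX Y hY => commutator_mem_m102 hX hY,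
    fun X hX Y hY => commutator_eq_zero_of_mem_m102 hX hY, m101_subset_m102,
    fun X hX Y hY => commutator_eq_zero_of_mem_m102 (m101_subset_m102 hX) (m101_subset_m102 hY),
    fun A Y hY => commutator_mem_m102 ⟨A, 0, 0, rfl⟩ (m101_subset_m102 hY)⟩
  · simpa [h3] using h3_commutator A A' 0 0 0 0
  · simpa [h3, Matrix.trace_fin_two] using h3_commutator A 0 0 v 0 y
  · rintro _ ⟨A, v, y, rfl⟩ _ ⟨A', v', y', rfl⟩
    exact ⟨_, _, _, h3_commutator A A' v v' y y'⟩
  · rintro _ ⟨v, y, rfl⟩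
    exact ⟨0, v, y, rfl⟩
end
end

section
/- Let 𝔥 ⊆ 𝔥^III be a linear subspace closed under the matrix commutator such that: 𝔥 is abelian (XY = YX for all X,Y ∈ 𝔥); 𝔥 is indecomposable; and the action of 𝔥 on the invariant plane span{e_2,e_3} is semisimple, i.e. every subspace of span{e_2,e_3} invariant under all X ∈ 𝔥 admits a complement in span{e_2,e_3} invariant under all X ∈ 𝔥. Then there exists g ∈ GL(7,ℝ) with ω₀(gu,gv,gw) = ω₀(u,v,w) for all u,v,w ∈ ℝ^7 such that g𝔥g⁻¹ = 𝔪(1,0,1) or g𝔥g⁻¹ = 𝔪(1,0,2). -/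
open Matrix

noncomputable section

/-- A set of matrices is decomposable if some nontrivial proper subspace `W` is invariant
and the restriction of `⟨·,·⟩` to `W` is nondegenerate. -/
def Decomposable (H : Set M7) : Prop :=
  ∃ W : Submodule ℝ V7, W ≠ ⊥ ∧ W ≠ ⊤ ∧
    (∀ X ∈ H, ∀ w ∈ W, X.mulVec w ∈ W) ∧
    (∀ w ∈ W, (∀ w' ∈ W, ip w w' = 0) → w = 0)


/-- The exponential of `h(0, 0, u, 0)` for `u = (0, t)`. -/
def unip (t : ℝ) : M7 :=
  !![1, -t, 0, 0, 0, 0, 0;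
     0, 1, 0, 0, 0, 0, 0;
     0, 0, 1, Real.sqrt 2 * t, 0, 0, t ^ 2;
     0, 0, 0, 1, 0, 0, Real.sqrt 2 * t;
     0, 0, 0, 0, 1, 0, 0;
     0, 0, 0, 0, t, 1, 0;
     0, 0, 0, 0, 0, 0, 1]

/-- The rotation of the plane spanned by `e 1, e 2`, extended to an element of the stabilizer
of `om0`. -/
def rot (c s : ℝ) : M7 :=
  !![1, 0, 0, 0, 0, 0, 0;
     0, c, s, 0, 0, 0, 0;
     0, -s, c, 0, 0, 0, 0;
     0, 0, 0, 1, 0, 0, 0;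
     0, 0, 0, 0, 1, 0, 0;
     0, 0, 0, 0, 0, c, s;
     0, 0, 0, 0, 0, -s, c]

lemma sqrt_two_mul_self : Real.sqrt 2 * Real.sqrt 2 = 2 := Real.mul_self_sqrt (by norm_num)

lemma om0_unip (t : ℝ) (u v w : V7) :
    om0 ((unip t).mulVec u) ((unip t).mulVec v) ((unip t).mulVec w) = om0 u v w := by
  have h : Real.sqrt 2 ^ 2 = 2 := Real.sq_sqrt (by norm_num)
  simp [om0, tri, det3, unip, Matrix.mulVec, dotProduct, Fin.sum_univ_succ]
  ring_nf
  simp only [h]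
  ring

lemma om0_rot (c s : ℝ) (hcs : c ^ 2 + s ^ 2 = 1) (u v w : V7) :
    om0 ((rot c s).mulVec u) ((rot c s).mulVec v) ((rot c s).mulVec w) = om0 u v w := by
  simp [om0, tri, det3, rot, Matrix.mulVec, dotProduct, Fin.sum_univ_succ]
  have hc : c ^ 2 = 1 - s ^ 2 := by linarith
  ring_nf
  simp only [hc]
  ring

lemma unip_mul (t : ℝ) : unip t * unip (-t) = 1 := by
  ext i j
  fin_cases i <;> fin_cases j <;> simp [unip, Matrix.mul_apply, Fin.sum_univ_succ]
  linear_combination (-t ^ 2) * sqrt_two_mul_self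

lemma rot_mul (c s : ℝ) (hcs : c ^ 2 + s ^ 2 = 1) : rot c s * rot c (-s) = 1 := by
  ext i j
  fin_cases i <;> fin_cases j <;> simp [rot, Matrix.mul_apply, Fin.sum_univ_succ] <;>
    first | ring1 | linear_combination hcs

lemma unip_conj (t v : ℝ) (y : Fin 2 → ℝ) :
    unip t * h3 0 v y = h3 0 v ![y 0, y 1 + 3 * t * v] * unip t := by
  ext i j
  fin_cases i <;> fin_cases j <;> simp [unip, h3, hmat, Matrix.mul_apply, Fin.sum_univ_succ]
  all_goals
    first
    | ring1
    | linear_combination (t * v) * sqrt_two_mul_self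
    | linear_combination (-t * v) * sqrt_two_mul_self

lemma rot_conj (c s v : ℝ) (hcs : c ^ 2 + s ^ 2 = 1) (y : Fin 2 → ℝ) :
    rot c s * h3 0 v y = h3 0 v ![c * y 0 + s * y 1, -s * y 0 + c * y 1] * rot c s := by
  ext i j
  fin_cases i <;> fin_cases j <;> simp [rot, h3, hmat, Matrix.mul_apply, Fin.sum_univ_succ]
  all_goals
    first
    | ring1
    | linear_combination v * hcs
    | linear_combination (-v) * hcs
    | linear_combination (y 0) * hcs
    | linear_combination (y 1) * hcs

lemma ip_h3_skew (A : M2) (v : ℝ) (y : Fin 2 → ℝ) (a b : V7) :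
    ip ((h3 A v y).mulVec a) b = - ip a ((h3 A v y).mulVec b) := by
  simp [ip, h3, hmat, Matrix.mulVec, dotProduct, Fin.sum_univ_succ]
  ring

lemma ip_add_right (a b c : V7) : ip a (b + c) = ip a b + ip a c := by
  simp [ip]; ring

lemma eq_zero_of_ip_eq_zero (a : V7) (h : ∀ b, ip a b = 0) : a = 0 := by
  ext i
  have h0 := h (e 0)
  have h1 := h (e 1)
  have h2 := h (e 2)
  have h3 := h (e 3)
  have h4 := h (e 4)
  have h5 := h (e 5)
  have h6 := h (e 6)
  simp [ip, e] at h0 h1 h2 h3 h4 h5 h6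
  fin_cases i <;> simp [*]

lemma exists_ker (A : M2) (v : ℝ) (y : Fin 2 → ℝ) :
    ∃ w : V7, w ≠ 0 ∧ (h3 A v y).mulVec w = 0 := by
  by_cases ht : A 0 0 + A 1 1 = 0
  · refine ⟨e 0, fun h => by simpa [e] using congrFun h 0, ?_⟩
    ext i
    fin_cases i <;> simp [h3, hmat, e, ht]
  · refine ⟨(A 0 0 + A 1 1) • e 3 - (Real.sqrt 2 * v) • e 0,
      fun h => ht (by simpa [e] using congrFun h 3), ?_⟩
    ext i
    fin_cases i <;> simp [h3, hmat, e, Matrix.mulVec_sub, Matrix.mulVec_smul]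
    ring

lemma isNilpotent_of_not_decomposable {H : Set M7} (hH : H ⊆ hIII)
    (habel : ∀ X ∈ H, ∀ Y ∈ H, X * Y = Y * X) (hindec : ¬ Decomposable H)
    {X : M7} (hX : X ∈ H) : IsNilpotent X := by
  obtain ⟨A, v, y, rfl⟩ := hH hX
  set X := h3 A v y with hXdef
  obtain ⟨n, hn1, hn⟩ := ((Filter.eventually_ge_atTop 1).and
    (LinearMap.eventually_isCompl_ker_pow_range_pow (Matrix.toLin' X))).exists
  rw [← Matrix.toLin'_pow] at hn
  have hskew : ∀ (k : ℕ) (a b : V7),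
      ip ((X ^ k).mulVec a) b = (-1) ^ k * ip a ((X ^ k).mulVec b) := by
    intro k
    induction k with
    | zero => simp
    | succ k ih =>
      intro a b
      rw [pow_succ, ← Matrix.mulVec_mulVec, ih, ip_h3_skew, Matrix.mulVec_mulVec, ← hXdef,
        ← pow_succ', pow_succ, pow_succ]
      ring
  by_cases htop : LinearMap.ker (Matrix.toLin' (X ^ n)) = ⊤
  · exact ⟨n, Matrix.toLin'.injective (by rw [LinearMap.ker_eq_top.1 htop, map_zero])⟩
  refine absurd ⟨_, ?_, htop, ?_, ?_⟩ hindec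
  · obtain ⟨w, hw, hXw⟩ := exists_ker A v y
    refine (Submodule.ne_bot_iff _).2 ⟨w, ?_, hw⟩
    obtain ⟨m, rfl⟩ := Nat.exists_eq_add_of_le' hn1
    rw [LinearMap.mem_ker, Matrix.toLin'_apply, pow_succ, ← Matrix.mulVec_mulVec, hXw,
      Matrix.mulVec_zero]
  · intro Y hY w hw
    rw [LinearMap.mem_ker, Matrix.toLin'_apply] at hw ⊢
    have hc : Commute (X ^ n) Y := Commute.pow_left (habel X hX Y hY) n
    rw [Matrix.mulVec_mulVec, hc.eq, ← Matrix.mulVec_mulVec, hw, Matrix.mulVec_zero]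
  · intro w hw hort
    refine eq_zero_of_ip_eq_zero w fun b => ?_
    obtain ⟨p, hp, q, ⟨r, rfl⟩, rfl⟩ := Submodule.mem_sup.1
      (hn.sup_eq_top ▸ Submodule.mem_top : b ∈ _ ⊔ _)
    rw [LinearMap.mem_ker, Matrix.toLin'_apply] at hw
    have h := hskew n w r
    rw [hw] at h
    have h0 : ip 0 r = 0 := by simp [ip]
    rw [ip_add_right, hort p hp, Matrix.toLin'_apply]
    rw [h0] at h
    rcases mul_eq_zero.1 h.symm with h | h
    · exact absurd h (by simp)
    · simpa using h

/-- The inclusion of `ℝ^2` as the plane spanned by `e 1, e 2`. -/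
def emb (x : Fin 2 → ℝ) : V7 := ![0, x 0, x 1, 0, 0, 0, 0]

lemma mulVec_emb (A : M2) (v : ℝ) (y x : Fin 2 → ℝ) :
    (h3 A v y).mulVec (emb x) = emb (A.mulVec x) := by
  ext i
  fin_cases i <;> simp [h3, hmat, emb, Matrix.mulVec, dotProduct, Fin.sum_univ_succ]

lemma emb_injective : Function.Injective emb := by
  intro x y h
  ext i
  fin_cases i
  · exact congrFun h 1
  · exact congrFun h 2

lemma mem_span_iff (w : V7) : w ∈ Submodule.span ℝ {e 1, e 2} ↔ ∃ x, w = emb x := by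
  rw [Submodule.mem_span_pair]
  constructor
  · rintro ⟨a, b, rfl⟩
    refine ⟨![a, b], ?_⟩
    ext i
    fin_cases i <;> simp [emb, e]
  · rintro ⟨x, rfl⟩
    refine ⟨x 0, x 1, ?_⟩
    ext i
    fin_cases i <;> simp [emb, e]

lemma isNilpotent_block {A : M2} {v : ℝ} {y : Fin 2 → ℝ} (h : IsNilpotent (h3 A v y)) :
    IsNilpotent A := by
  obtain ⟨n, hn⟩ := h
  have key : ∀ (k : ℕ) (x : Fin 2 → ℝ),
      (h3 A v y ^ k).mulVec (emb x) = emb ((A ^ k).mulVec x) := by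
    intro k
    induction k with
    | zero => simp
    | succ k ih =>
      intro x
      rw [pow_succ, ← Matrix.mulVec_mulVec, mulVec_emb, ih, Matrix.mulVec_mulVec, ← pow_succ]
  refine ⟨n, Matrix.toLin'.injective (LinearMap.ext fun x => emb_injective ?_)⟩
  rw [Matrix.toLin'_apply, ← key, hn, map_zero, Matrix.zero_mulVec]
  ext i
  fin_cases i <;> simp [emb]

lemma sq_eq_zero_of_isNilpotent {A : M2} (h : IsNilpotent A) : A * A = 0 := by
  have ht : A.trace = 0 := (Matrix.isNilpotent_trace_of_isNilpotent h).eq_zero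
  have hd : A.det = 0 := by
    obtain ⟨n, hn⟩ := h
    refine eq_zero_of_pow_eq_zero (n := n + 1) ?_
    rw [← Matrix.det_pow, pow_succ, hn, zero_mul, Matrix.det_zero]
  rw [Matrix.trace_fin_two] at ht
  rw [Matrix.det_fin_two] at hd
  ext i j
  fin_cases i <;> fin_cases j <;> simp [Matrix.mul_apply]
  · linear_combination A 0 0 * ht - hd
  · linear_combination A 0 1 * ht
  · linear_combination A 1 0 * ht
  · linear_combination A 1 1 * ht - hd

lemma block_eq_zero {H : Set M7} (hH : H ⊆ hIII)
    (habel : ∀ X ∈ H, ∀ Y ∈ H, X * Y = Y * X)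
    (hss : ∀ U : Submodule ℝ V7, U ≤ Submodule.span ℝ {e 1, e 2} →
      (∀ X ∈ H, ∀ w ∈ U, X.mulVec w ∈ U) →
      ∃ U' : Submodule ℝ V7, U' ≤ Submodule.span ℝ {e 1, e 2} ∧
        (∀ X ∈ H, ∀ w ∈ U', X.mulVec w ∈ U') ∧
        U ⊓ U' = ⊥ ∧ U ⊔ U' = Submodule.span ℝ {e 1, e 2})
    {A : M2} {v : ℝ} {y : Fin 2 → ℝ} (hX : h3 A v y ∈ H) (hnil : IsNilpotent (h3 A v y)) :
    A = 0 := by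
  have hsq := sq_eq_zero_of_isNilpotent (isNilpotent_block hnil)
  set L : Submodule ℝ V7 := Submodule.span ℝ {e 1, e 2}
  set X := h3 A v y with hXdef
  obtain ⟨U', hU', hinv, hinf, hsup⟩ := hss (L ⊓ LinearMap.ker (Matrix.toLin' X)) inf_le_left (by
    rintro Y hY w ⟨hw, hXw⟩
    refine ⟨?_, ?_⟩
    · obtain ⟨B, v', y', rfl⟩ := hH hY
      obtain ⟨x, rfl⟩ := (mem_span_iff w).1 hw
      exact (mem_span_iff _).2 ⟨_, mulVec_emb B v' y' x⟩
    · rw [SetLike.mem_coe, LinearMap.mem_ker, Matrix.toLin'_apply] at hXw ⊢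
      rw [Matrix.mulVec_mulVec, habel X hX Y hY, ← Matrix.mulVec_mulVec, hXw, Matrix.mulVec_zero])
  have hker : U' ≤ LinearMap.ker (Matrix.toLin' X) := by
    intro w hw
    have hXw := hinv X hX w hw
    obtain ⟨x, rfl⟩ := (mem_span_iff w).1 (hU' hw)
    have : X.mulVec (emb x) ∈ (L ⊓ LinearMap.ker (Matrix.toLin' X)) ⊓ U' := by
      refine ⟨⟨hU' hXw, ?_⟩, hXw⟩
      rw [SetLike.mem_coe, LinearMap.mem_ker, Matrix.toLin'_apply, mulVec_emb, mulVec_emb,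
        Matrix.mulVec_mulVec, hsq, Matrix.zero_mulVec]
      ext i
      fin_cases i <;> simp [emb]
    rw [hinf, Submodule.mem_bot] at this
    exact this
  have hL : L ≤ LinearMap.ker (Matrix.toLin' X) := hsup ▸ sup_le inf_le_right hker
  refine Matrix.toLin'.injective (LinearMap.ext fun x => emb_injective ?_)
  have h := hL ((mem_span_iff _).2 ⟨x, rfl⟩)
  rw [LinearMap.mem_ker, Matrix.toLin'_apply, mulVec_emb] at h
  rw [Matrix.toLin'_apply, h, map_zero]
  ext i
  fin_cases i <;> simp [emb]

lemma exists_ne_zero_of_not_decomposable {H : Set M7} (hH : H ⊆ m102) (hindec : ¬ Decomposable H) :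
    ∃ v y, v ≠ 0 ∧ h3 0 v y ∈ H := by
  by_contra! hv
  refine hindec ⟨Submodule.span ℝ {e 3}, ?_, ?_, ?_, ?_⟩
  · rw [Ne, Submodule.span_singleton_eq_bot]
    exact fun h => by simpa [e] using congrFun h 3
  · intro h
    obtain ⟨a, ha⟩ := Submodule.mem_span_singleton.1 (h ▸ Submodule.mem_top : e 0 ∈ _)
    simpa [e] using congrFun ha 0
  · intro X hX w hw
    obtain ⟨v, y, rfl⟩ := hH hX
    obtain ⟨a, rfl⟩ := Submodule.mem_span_singleton.1 hw
    have hv0 : v = 0 := by_contra fun h => hv v y h hX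
    convert Submodule.zero_mem _
    ext i
    fin_cases i <;> simp [h3, hmat, e, Matrix.mulVec_smul, hv0]
  · intro w hw h
    obtain ⟨a, rfl⟩ := Submodule.mem_span_singleton.1 hw
    have := h _ (Submodule.mem_span_singleton_self _)
    simp [ip, e] at this
    simp [this]

lemma smul_add_smul_h3 (a b v v' : ℝ) (y y' : Fin 2 → ℝ) :
    a • h3 0 v y + b • h3 0 v' y' = h3 0 (a * v + b * v') (a • y + b • y') := by
  ext i j
  fin_cases i <;> fin_cases j <;> simp [h3, hmat] <;> ring

lemma decomposable_span {H : Set M7} (y : Fin 2 → ℝ) (hH : ∀ X ∈ H, ∃ a : ℝ, X = a • h3 0 1 y) :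
    Decomposable H := by
  have hmem : ∀ w : V7, w ∈ Submodule.span ℝ {e 4, (h3 0 1 y).mulVec (e 4), e 0} ↔
      ∃ a b c : ℝ, w = ![c, b * y 0, b * y 1, b * Real.sqrt 2, a, 0, 0] := by
    intro w
    have : ∀ a b c : ℝ, a • e 4 + b • (h3 0 1 y).mulVec (e 4) + c • e 0 =
        ![c, b * y 0, b * y 1, b * Real.sqrt 2, a, 0, 0] := by
      intro a b c
      ext i
      fin_cases i <;> simp [h3, hmat, e]
    simp_rw [Submodule.mem_span_triple, this, eq_comm]
  refine ⟨Submodule.span ℝ {e 4, (h3 0 1 y).mulVec (e 4), e 0}, ?_, ?_, ?_, ?_⟩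
  · refine (Submodule.ne_bot_iff _).2 ⟨e 4, Submodule.subset_span (by simp), ?_⟩
    exact fun h => by simpa [e] using congrFun h 4
  · intro h
    obtain ⟨a, b, c, ha⟩ := (hmem (e 5)).1 (h ▸ Submodule.mem_top)
    simpa [e] using congrFun ha 5
  · intro X hX w hw
    obtain ⟨r, rfl⟩ := hH X hX
    obtain ⟨a, b, c, rfl⟩ := (hmem w).1 hw
    rw [Matrix.smul_mulVec]
    refine Submodule.smul_mem _ _ ((hmem _).2 ⟨0, a, 2 * b, ?_⟩)
    ext i
    fin_cases i <;> simp [h3, hmat, Matrix.mulVec, dotProduct, Fin.sum_univ_succ]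
    all_goals first | ring1 | linear_combination b * sqrt_two_mul_self
  · intro w hw h
    obtain ⟨a, b, c, rfl⟩ := (hmem w).1 hw
    have e1 := h _ ((hmem _).2 ⟨1, 0, 0, rfl⟩)
    have e2 := h _ ((hmem _).2 ⟨0, 1, 0, rfl⟩)
    have e3 := h _ ((hmem _).2 ⟨0, 0, 1, rfl⟩)
    simp [ip] at e1 e2 e3
    ext i
    fin_cases i <;> simp [e1, e2, e3]

/-- `g = unip t * rot c s` as an element of `GL(7, ℝ)`. -/
def unipRot (t c s : ℝ) (hcs : c ^ 2 + s ^ 2 = 1) : GL (Fin 7) ℝ :=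
  Matrix.GeneralLinearGroup.mk'' (unip t * rot c s) (by
    refine (Matrix.isUnit_iff_isUnit_det _).1 (IsUnit.mul ?_ ?_)
    · exact IsUnit.of_mul_eq_one _ (unip_mul t)
    · exact IsUnit.of_mul_eq_one _ (rot_mul c s hcs))

lemma coe_unipRot (t c s : ℝ) (hcs : c ^ 2 + s ^ 2 = 1) :
    (unipRot t c s hcs : M7) = unip t * rot c s := rfl

lemma om0_unipRot (t c s : ℝ) (hcs : c ^ 2 + s ^ 2 = 1) (u v w : V7) :
    om0 ((unipRot t c s hcs : M7).mulVec u) ((unipRot t c s hcs : M7).mulVec v)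
      ((unipRot t c s hcs : M7).mulVec w) = om0 u v w := by
  simp_rw [coe_unipRot, ← Matrix.mulVec_mulVec, om0_unip, om0_rot c s hcs]

lemma unipRot_conj (t c s : ℝ) (hcs : c ^ 2 + s ^ 2 = 1) (v : ℝ) (y : Fin 2 → ℝ) :
    (unipRot t c s hcs : M7) * h3 0 v y * ((unipRot t c s hcs)⁻¹ : GL (Fin 7) ℝ) =
      h3 0 v ![c * y 0 + s * y 1, -s * y 0 + c * y 1 + 3 * t * v] := by
  rw [Units.mul_inv_eq_iff_eq_mul, coe_unipRot, Matrix.mul_assoc, rot_conj c s v hcs,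
    ← Matrix.mul_assoc, unip_conj, Matrix.mul_assoc]
  simp

lemma exists_conj_eq_m101 {S : Submodule ℝ M7} (hS : (S : Set M7) ⊆ m102) {y₀ p : Fin 2 → ℝ}
    (hy₀ : h3 0 1 y₀ ∈ S) (hp : h3 0 0 p ∈ S) (hp0 : p ≠ 0)
    (hpar : ∀ q, h3 0 0 q ∈ S → p 0 * q 1 - p 1 * q 0 = 0) :
    ∃ g : GL (Fin 7) ℝ,
      (∀ u v w : V7,
        om0 ((g : M7).mulVec u) ((g : M7).mulVec v) ((g : M7).mulVec w) = om0 u v w) ∧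
      (fun X => (g : M7) * X * ((g⁻¹ : GL (Fin 7) ℝ) : M7)) '' (S : Set M7) = m101 := by
  set n := Real.sqrt (p 0 ^ 2 + p 1 ^ 2) with hn
  have hpos : 0 < p 0 ^ 2 + p 1 ^ 2 := by
    refine lt_of_le_of_ne (by positivity) fun h => hp0 ?_
    ext i
    fin_cases i
    · simp
      nlinarith
    · simp
      nlinarith
  have hn0 : n ≠ 0 := (Real.sqrt_pos.2 hpos).ne'
  have hn2 : n ^ 2 = p 0 ^ 2 + p 1 ^ 2 := Real.sq_sqrt hpos.le
  obtain ⟨c, hc⟩ : ∃ c, p 0 = n * c := ⟨p 0 / n, by field_simp⟩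
  obtain ⟨s, hs⟩ : ∃ s, p 1 = n * s := ⟨p 1 / n, by field_simp⟩
  have hcs : c ^ 2 + s ^ 2 = 1 := by
    refine mul_left_cancel₀ (pow_ne_zero 2 hn0) ?_
    rw [hc, hs] at hn2
    linear_combination -hn2
  refine ⟨unipRot (-(-s * y₀ 0 + c * y₀ 1) / 3) c s hcs, om0_unipRot _ c s hcs, ?_⟩
  ext Z
  constructor
  · rintro ⟨X, hX, rfl⟩
    obtain ⟨v, y, rfl⟩ := hS hX
    refine ⟨v, c * y 0 + s * y 1, ?_⟩
    have hq := hpar (y - v • y₀) (by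
      have := S.add_mem (S.smul_mem 1 hX) (S.smul_mem (-v) hy₀)
      rw [smul_add_smul_h3] at this
      convert this using 2
      · ring
      · rw [one_smul, neg_smul, sub_eq_add_neg])
    rw [hc, hs] at hq
    have hq' : c * (y 1 - v * y₀ 1) - s * (y 0 - v * y₀ 0) = 0 :=
      mul_left_cancel₀ hn0 (by simp at hq; linear_combination hq)
    simp only [unipRot_conj]
    congr 1
    ext i
    fin_cases i
    · rfl
    · simp
      linear_combination hq'
  · rintro ⟨v, z, rfl⟩
    have hX := S.add_mem (S.smul_mem v hy₀)
      (S.smul_mem ((z - v * (c * y₀ 0 + s * y₀ 1)) / n) hp)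
    rw [smul_add_smul_h3] at hX
    refine ⟨_, hX, ?_⟩
    simp only [unipRot_conj]
    congr 1
    · ring
    · ext i
      fin_cases i
      · simp [hc, hs]
        field_simp
        linear_combination (z - v * (c * y₀ 0 + s * y₀ 1)) * hcs
      · simp [hc, hs]
        field_simp
        ring

lemma eq_m102 {S : Submodule ℝ M7} (hS : (S : Set M7) ⊆ m102) {y₀ p q : Fin 2 → ℝ}
    (hy₀ : h3 0 1 y₀ ∈ S) (hp : h3 0 0 p ∈ S) (hq : h3 0 0 q ∈ S)
    (hpq : p 0 * q 1 - p 1 * q 0 ≠ 0) : (S : Set M7) = m102 := by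
  refine hS.antisymm ?_
  rintro _ ⟨v, y, rfl⟩
  set d := p 0 * q 1 - p 1 * q 0 with hd
  set z := y - v • y₀ with hz
  have h := S.add_mem (S.smul_mem ((z 0 * q 1 - z 1 * q 0) / d) hp)
    (S.smul_mem ((p 0 * z 1 - p 1 * z 0) / d) hq)
  rw [smul_add_smul_h3] at h
  have h' := S.add_mem (S.smul_mem v hy₀) (S.smul_mem 1 h)
  rw [smul_add_smul_h3] at h'
  rw [SetLike.mem_coe]
  convert h' using 2
  · ring
  · have hz0 : y = v • y₀ + z := by rw [hz]; abel
    rw [hz0, one_smul]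
    congr 1
    ext i
    fin_cases i
    · simp
      field_simp
      rw [hd]
      ring
    · simp
      field_simp
      rw [hd]
      ring

theorem stmt3 (S : Submodule ℝ M7) (hsub : (S : Set M7) ⊆ hIII)
    (hclosed : ∀ X ∈ S, ∀ Y ∈ S, X * Y - Y * X ∈ S)
    (habel : ∀ X ∈ S, ∀ Y ∈ S, X * Y = Y * X)
    (hindec : ¬ Decomposable (S : Set M7))
    (hss : ∀ U : Submodule ℝ V7, U ≤ Submodule.span ℝ {e 1, e 2} →
      (∀ X ∈ S, ∀ w ∈ U, X.mulVec w ∈ U) →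
      ∃ U' : Submodule ℝ V7, U' ≤ Submodule.span ℝ {e 1, e 2} ∧
        (∀ X ∈ S, ∀ w ∈ U', X.mulVec w ∈ U') ∧
        U ⊓ U' = ⊥ ∧ U ⊔ U' = Submodule.span ℝ {e 1, e 2}) :
    ∃ g : GL (Fin 7) ℝ,
      (∀ u v w : V7,
        om0 ((g : M7).mulVec u) ((g : M7).mulVec v) ((g : M7).mulVec w) = om0 u v w) ∧
      ((fun X => (g : M7) * X * ((g⁻¹ : GL (Fin 7) ℝ) : M7)) '' (S : Set M7) = m101 ∨
       (fun X => (g : M7) * X * ((g⁻¹ : GL (Fin 7) ℝ) : M7)) '' (S : Set M7) = m102) := by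
  have hm : (S : Set M7) ⊆ m102 := by
    intro X hX
    obtain ⟨A, v, y, rfl⟩ := hsub hX
    rw [block_eq_zero hsub habel hss hX (isNilpotent_of_not_decomposable hsub habel hindec hX)]
    exact ⟨v, y, rfl⟩
  obtain ⟨v, y, hv, hX⟩ := exists_ne_zero_of_not_decomposable hm hindec
  obtain ⟨y₀, hy₀⟩ : ∃ y₀, h3 0 1 y₀ ∈ S := by
    refine ⟨v⁻¹ • y, ?_⟩
    have := S.add_mem (S.smul_mem v⁻¹ hX) (S.smul_mem 0 hX)
    rw [smul_add_smul_h3] at this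
    simpa [hv] using this
  obtain ⟨p, hp, hp0⟩ : ∃ p, h3 0 0 p ∈ S ∧ p ≠ 0 := by
    by_contra! h
    refine hindec (decomposable_span y₀ fun X hX => ?_)
    obtain ⟨v, y, rfl⟩ := hm hX
    have hd := S.add_mem (S.smul_mem 1 hX) (S.smul_mem (-v) hy₀)
    rw [smul_add_smul_h3, one_mul, mul_one, add_neg_cancel] at hd
    have hy : y = v • y₀ := by
      have := h _ hd
      rwa [one_smul, neg_smul, ← sub_eq_add_neg, sub_eq_zero] at this
    refine ⟨v, ?_⟩
    have := smul_add_smul_h3 v 0 1 0 y₀ 0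
    simpa [hy] using this.symm
  by_cases hpar : ∀ q, h3 0 0 q ∈ S → p 0 * q 1 - p 1 * q 0 = 0
  · obtain ⟨g, hg, hgS⟩ := exists_conj_eq_m101 hm hy₀ hp hp0 hpar
    exact ⟨g, hg, Or.inl hgS⟩
  · push Not at hpar
    obtain ⟨q, hq, hpq⟩ := hpar
    refine ⟨1, by simp, Or.inr ?_⟩
    simpa using eq_m102 hm hy₀ hp hq hpq
end
end

section
/- For every R ∈ K(𝔥^III) the following hold: R(e_1,e_j) = 0 for j ∈ {2,3,4,6,7}; R(e_2,e_j) = 0 for j ∈ {3,4,5}; R(e_3,e_4) = 0 and R(e_3,e_5) = 0; R(e_4,e_6) = 0 and R(e_4,e_7) = 0; R(e_3,e_7) = R(e_1,e_5) − R(e_2,e_6); √2·R(e_6,e_7) = −R(e_4,e_5); pro_A(R(e_i,e_j)) = 0 for all i,j ∈ {1,2,3,4,5}; pro_v(R(e_i,e_j)) = 0 whenever {i,j} is neither {5,6} nor {5,7}; and tr pro_A(R(e_2,e_6)) = tr pro_A(R(e_2,e_7)) = tr pro_A(R(e_3,e_6)) = 0. -/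
open Matrix

noncomputable section

/-- The projection `pro_A` (reading off the relevant entries; on `𝔥^III` and `𝔥^I`
it gives the `𝔤𝔩(2,ℝ)`-component `A`). -/
def proA (X : M7) : M2 := !![X 1 1, X 1 2; X 2 1, X 2 2]

/-- The projection `pro_v` (on `𝔥^III` and `𝔥^I` it gives the component `v`). -/
def proV (X : M7) : ℝ := X 1 6

/-- A four-index tensor with the skew symmetries and the first Bianchi identity of a curvature
tensor is invariant under exchanging the two index pairs. -/
theorem pair_symm_of_bianchi {ι : Type*} (T : ι → ι → ι → ι → ℝ)
    (hleft : ∀ i j k l, T i j k l = -T j i k l)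
    (hright : ∀ i j k l, T i j k l = -T i j l k)
    (hcyc : ∀ i j k l, T i j k l + T j k i l + T k i j l = 0) (i j k l : ι) :
    T i j k l = T k l i j := by
  linarith [hcyc i j k l, hcyc j k l i, hcyc k l i j, hcyc l i j k,
    hright j k i l, hright k i j l, hright j k l i, hright k l j i,
    hright l j k i, hleft l j k i, hright k l i j, hright l i k j, hleft l i j k, hleft l i k j,
    hleft i k l j, hright i k l j, hleft i j l k, hright i j l k, hright j l i k, hleft j l i k,
    hright l i j k]

/-- The Gram matrix of the split-signature metric preserved by `𝔥^III`. -/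
def gramMatrix : M7 :=
  !![0, 0, 0, 0, 1, 0, 0;
     0, 0, 0, 0, 0, 1, 0;
     0, 0, 0, 0, 0, 0, 1;
     0, 0, 0, -1, 0, 0, 0;
     1, 0, 0, 0, 0, 0, 0;
     0, 1, 0, 0, 0, 0, 0;
     0, 0, 1, 0, 0, 0, 0]

/-- The matrix `X` with its upper index lowered by the metric. -/
def lowered (X : M7) : M7 := gramMatrix * X

theorem gramMatrix_mul_self : gramMatrix * gramMatrix = 1 := by
  ext i j
  fin_cases i <;> fin_cases j <;> simp [gramMatrix, Matrix.mul_apply, Fin.sum_univ_succ]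

theorem lowered_injective : Function.Injective lowered := fun X Y h => by
  have h' := congrArg (gramMatrix * ·) h
  simpa [lowered, ← Matrix.mul_assoc, gramMatrix_mul_self] using h'

theorem lowered_h3 (A : M2) (v : ℝ) (y : Fin 2 → ℝ) :
    lowered (h3 A v y) =
      !![0, 0, 0, 0, -(A 0 0 + A 1 1), 0, 0;
         0, 0, 0, 0, 0, -A 0 0, -A 1 0;
         0, 0, 0, 0, 0, -A 0 1, -A 1 1;
         0, 0, 0, 0, -(Real.sqrt 2 * v), 0, 0;
         A 0 0 + A 1 1, 0, 0, Real.sqrt 2 * v, 0, -y 0, -y 1;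
         0, A 0 0, A 0 1, 0, y 0, 0, v;
         0, A 1 0, A 1 1, 0, y 1, -v, 0] := by
  ext i j
  fin_cases i <;> fin_cases j <;>
    simp [lowered, gramMatrix, h3, hmat, Matrix.mul_apply, Fin.sum_univ_succ]

theorem lowered_skew {X : M7} (hX : X ∈ hIII) (i j : Fin 7) :
    lowered X i j = -lowered X j i := by
  obtain ⟨A, v, y, rfl⟩ := hX
  rw [lowered_h3]
  fin_cases i <;> fin_cases j <;> simp

theorem proA_h3 (A : M2) (v : ℝ) (y : Fin 2 → ℝ) : proA (h3 A v y) = A := by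
  ext i j
  fin_cases i <;> fin_cases j <;> simp [proA, h3, hmat]

theorem proV_h3 (A : M2) (v : ℝ) (y : Fin 2 → ℝ) : proV (h3 A v y) = v := by
  simp [proV, h3, hmat]

section Curvature

variable {R : V7 →ₗ[ℝ] V7 →ₗ[ℝ] M7}

theorem curvature_swap (halt : ∀ x : V7, R x x = 0) (x y : V7) : R x y = -R y x := by
  have h := halt (x + y)
  simp only [map_add, LinearMap.add_apply, halt, zero_add, add_zero] at h
  exact eq_neg_of_add_eq_zero_right h

theorem bianchi_apply
    (hbianchi : ∀ x y z : V7,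
      (R x y).mulVec z + (R y z).mulVec x + (R z x).mulVec y = 0) (i j k l : Fin 7) :
    R (e i) (e j) l k + R (e j) (e k) l i + R (e k) (e i) l j = 0 := by
  simpa [e] using congrFun (hbianchi (e i) (e j) (e k)) l

theorem lowered_pair_symm (halt : ∀ x : V7, R x x = 0) (hval : ∀ x y : V7, R x y ∈ hIII)
    (hbianchi : ∀ x y z : V7,
      (R x y).mulVec z + (R y z).mulVec x + (R z x).mulVec y = 0) (i j k l : Fin 7) :
    lowered (R (e i) (e j)) k l = lowered (R (e k) (e l)) i j := by
  refine pair_symm_of_bianchi (fun i j k l => lowered (R (e i) (e j)) k l)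
    (fun i j k l => ?_) (fun i j k l => lowered_skew (hval _ _) k l) (fun i j k l => ?_) i j k l
  · simp only [lowered]
    rw [curvature_swap halt (e i), Matrix.mul_neg, Matrix.neg_apply]
  · have h : ∑ m, gramMatrix l m * (R (e i) (e j) m k + R (e j) (e k) m i + R (e k) (e i) m j)
        = 0 := Finset.sum_eq_zero fun m _ => by rw [bianchi_apply hbianchi, mul_zero]
    simp only [mul_add, Finset.sum_add_distrib] at h
    rw [lowered_skew (hval _ _) k l, lowered_skew (hval _ _) i l, lowered_skew (hval _ _) j l]
    simp only [lowered, Matrix.mul_apply]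
    linarith

theorem eq_zero_of_forall_lowered (halt : ∀ x : V7, R x x = 0) (hval : ∀ x y : V7, R x y ∈ hIII)
    (hbianchi : ∀ x y z : V7,
      (R x y).mulVec z + (R y z).mulVec x + (R z x).mulVec y = 0) {i j : Fin 7}
    (hij : ∀ (A : M2) (v : ℝ) (y : Fin 2 → ℝ), lowered (h3 A v y) i j = 0) :
    R (e i) (e j) = 0 := by
  refine lowered_injective ?_
  ext k l
  obtain ⟨A, v, y, h⟩ := hval (e k) (e l)
  rw [lowered_pair_symm halt hval hbianchi, h, hij]
  simp [lowered]

end Curvature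

theorem stmt4 (R : V7 →ₗ[ℝ] V7 →ₗ[ℝ] M7)
    (halt : ∀ x : V7, R x x = 0)
    (hval : ∀ x y : V7, R x y ∈ hIII)
    (hbianchi : ∀ x y z : V7,
      (R x y).mulVec z + (R y z).mulVec x + (R z x).mulVec y = 0) :
    R (e 0) (e 1) = 0 ∧ R (e 0) (e 2) = 0 ∧ R (e 0) (e 3) = 0 ∧
    R (e 0) (e 5) = 0 ∧ R (e 0) (e 6) = 0 ∧
    R (e 1) (e 2) = 0 ∧ R (e 1) (e 3) = 0 ∧ R (e 1) (e 4) = 0 ∧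
    R (e 2) (e 3) = 0 ∧ R (e 2) (e 4) = 0 ∧
    R (e 3) (e 5) = 0 ∧ R (e 3) (e 6) = 0 ∧
    R (e 2) (e 6) = R (e 0) (e 4) - R (e 1) (e 5) ∧
    Real.sqrt 2 • R (e 5) (e 6) = - R (e 3) (e 4) ∧
    (∀ i j : Fin 7, i.val < 5 → j.val < 5 → proA (R (e i) (e j)) = 0) ∧
    (∀ i j : Fin 7,
      ¬((i = 4 ∧ j = 5) ∨ (i = 5 ∧ j = 4) ∨ (i = 4 ∧ j = 6) ∨ (i = 6 ∧ j = 4)) →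
      proV (R (e i) (e j)) = 0) ∧
    (proA (R (e 1) (e 5))).trace = 0 ∧ (proA (R (e 1) (e 6))).trace = 0 ∧
    (proA (R (e 2) (e 5))).trace = 0 := by
  have hsymm := lowered_pair_symm halt hval hbianchi
  have hzero : ∀ i j : Fin 7,
      (∀ (A : M2) (v : ℝ) (y : Fin 2 → ℝ), lowered (h3 A v y) i j = 0) →
      R (e i) (e j) = 0 := fun i j => eq_zero_of_forall_lowered halt hval hbianchi
  have h01 : R (e 0) (e 1) = 0 := hzero 0 1 fun A v y => by simp [lowered_h3]
  have h02 : R (e 0) (e 2) = 0 := hzero 0 2 fun A v y => by simp [lowered_h3]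
  have h03 : R (e 0) (e 3) = 0 := hzero 0 3 fun A v y => by simp [lowered_h3]
  have h05 : R (e 0) (e 5) = 0 := hzero 0 5 fun A v y => by simp [lowered_h3]
  have h06 : R (e 0) (e 6) = 0 := hzero 0 6 fun A v y => by simp [lowered_h3]
  have h12 : R (e 1) (e 2) = 0 := hzero 1 2 fun A v y => by simp [lowered_h3]
  have h13 : R (e 1) (e 3) = 0 := hzero 1 3 fun A v y => by simp [lowered_h3]
  have h14 : R (e 1) (e 4) = 0 := hzero 1 4 fun A v y => by simp [lowered_h3]
  have h23 : R (e 2) (e 3) = 0 := hzero 2 3 fun A v y => by simp [lowered_h3]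
  have h24 : R (e 2) (e 4) = 0 := hzero 2 4 fun A v y => by simp [lowered_h3]
  have h35 : R (e 3) (e 5) = 0 := hzero 3 5 fun A v y => by simp [lowered_h3]
  have h36 : R (e 3) (e 6) = 0 := hzero 3 6 fun A v y => by simp [lowered_h3]
  have hswap : ∀ i j : Fin 7, R (e i) (e j) = -R (e j) (e i) := fun i j =>
    curvature_swap halt _ _
  have hB := bianchi_apply hbianchi
  have hA04 : proA (R (e 0) (e 4)) = 0 := by
    have key1 : ∀ l, R (e 0) (e 4) l 1 = 0 := fun l => by
      simpa [hswap 4 1, hswap 1 0, h14, h01] using hB 0 4 1 l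
    have key2 : ∀ l, R (e 0) (e 4) l 2 = 0 := fun l => by
      simpa [hswap 4 2, hswap 2 0, h24, h02] using hB 0 4 2 l
    ext i j
    fin_cases i <;> fin_cases j <;> simp [proA, key1, key2]
  have hA34 : proA (R (e 3) (e 4)) = 0 := by
    have key1 : ∀ l, R (e 3) (e 4) l 1 = 0 := fun l => by
      simpa [hswap 4 1, h14, h13] using hB 3 4 1 l
    have key2 : ∀ l, R (e 3) (e 4) l 2 = 0 := fun l => by
      simpa [hswap 4 2, h24, h23] using hB 3 4 2 l
    ext i j
    fin_cases i <;> fin_cases j <;> simp [proA, key1, key2]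
  have hv34 : proV (R (e 3) (e 4)) = 0 := by
    have h := hB 3 4 6 1
    obtain ⟨A, v, y, hX⟩ := hval (e 4) (e 6)
    simpa [hswap 6 3, h36, hX, h3, hmat, proV] using h
  have hAtriv : ∀ i j : Fin 7, i.val < 5 → j.val < 5 → proA (R (e i) (e j)) = 0 := by
    have h0 : proA 0 = 0 := by
      ext i j; fin_cases i <;> fin_cases j <;> simp [proA]
    have hneg : ∀ X : M7, proA (-X) = -proA X := fun X => by
      ext i j; fin_cases i <;> fin_cases j <;> simp [proA]
    have hle : ∀ i j : Fin 7, i < j → j.val < 5 → proA (R (e i) (e j)) = 0 := by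
      intro i j hij hj
      fin_cases i <;> fin_cases j <;> simp at hij hj <;>
        simp [h01, h02, h03, h12, h13, h14, h23, h24, h0, hA04, hA34]
    intro i j hi hj
    rcases lt_trichotomy i j with h | rfl | h
    · exact hle i j h hj
    · rw [halt, h0]
    · rw [hswap, hneg, hle j i h hi, neg_zero]
  have htr : ∀ i j : Fin 7, (proA (R (e i) (e j))).trace = lowered (R (e 0) (e 4)) j i := by
    intro i j
    rw [lowered_skew (hval _ _), ← hsymm]
    obtain ⟨A, v, y, hX⟩ := hval (e i) (e j)
    simp [hX, lowered_h3, proA_h3, Matrix.trace_fin_two]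
  have hv : ∀ i j : Fin 7, Real.sqrt 2 * proV (R (e i) (e j)) = lowered (R (e 3) (e 4)) j i := by
    intro i j
    rw [lowered_skew (hval _ _), ← hsymm]
    obtain ⟨A, v, y, hX⟩ := hval (e i) (e j)
    simp [hX, lowered_h3, proV_h3]
  refine ⟨h01, h02, h03, h05, h06, h12, h13, h14, h23, h24, h35, h36, ?_, ?_, hAtriv, ?_,
    ?_, ?_, ?_⟩
  · refine lowered_injective ?_
    ext k l
    simp only [lowered, Matrix.mul_sub, Matrix.sub_apply]
    change lowered _ _ _ = lowered _ _ _ - lowered _ _ _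
    rw [hsymm 2 6, hsymm 0 4, hsymm 1 5]
    obtain ⟨A, v, y, hX⟩ := hval (e k) (e l)
    simp [hX, lowered_h3]
  · refine lowered_injective ?_
    ext k l
    simp only [lowered, Matrix.mul_neg, Matrix.mul_smul, Matrix.neg_apply, Matrix.smul_apply]
    change _ • lowered _ _ _ = -lowered _ _ _
    rw [hsymm 5 6, hsymm 3 4]
    obtain ⟨A, v, y, hX⟩ := hval (e k) (e l)
    simp [hX, lowered_h3]
  · intro i j hij
    have h2 : Real.sqrt 2 ≠ 0 := by positivity
    refine (mul_eq_zero.mp ?_).resolve_left h2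
    rw [hv]
    obtain ⟨A, v, y, hX⟩ := hval (e 3) (e 4)
    rw [hX, proA_h3] at hA34
    rw [hX, proV_h3] at hv34
    rw [hX, lowered_h3, hA34, hv34]
    fin_cases i <;> fin_cases j <;> simp at hij ⊢
  all_goals
    rw [htr]
    obtain ⟨A, v, y, hX⟩ := hval (e 0) (e 4)
    rw [hX, proA_h3] at hA04
    simp [hX, lowered_h3, hA04]
end
end

section
/- Let Λ : ℝ^7 → 𝔤𝔩(7,ℝ) be a linear map with Λ(x) ∈ 𝔥^III for all x ∈ ℝ^7, and define [x,y] := Λ(x)y − Λ(y)x. Then the subspaces span{e_1}, span{e_2,e_3}, span{e_1,e_2,e_3}, span{e_1,e_2,e_3,e_4} and span{e_1,e_2,e_3,e_4,e_5} are each closed under [·,·]; moreover [x,y] ∈ span{e_1,e_2,e_3} for all x ∈ span{e_1,e_2,e_3,e_4} and y ∈ span{e_1,e_2,e_3}, and [e_1,e_4] ∈ ℝ·e_1. -/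
open Matrix

noncomputable section

theorem mem_span_e_image {S : Set (Fin 7)} {x : V7} :
    x ∈ Submodule.span ℝ (e '' S) ↔ ∀ i ∉ S, x i = 0 := by
  have he : e = ⇑(Pi.basisFun ℝ (Fin 7)) := by
    funext i
    simp [e]
  rw [he, Module.Basis.mem_span_image]
  simp only [Set.subset_def, Finset.mem_coe, Finsupp.mem_support_iff, Pi.basisFun_repr]
  exact forall_congr' fun i => not_imp_comm

/-- A matrix whose entries with column in `S` and row outside `T` vanish maps the coordinate
subspace of `S` into that of `T`. -/
theorem mulVec_mem_span_e_image {S T : Set (Fin 7)} {X : M7}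
    (hX : ∀ i ∉ T, ∀ j ∈ S, X i j = 0) {x : V7} (hx : x ∈ Submodule.span ℝ (e '' S)) :
    X.mulVec x ∈ Submodule.span ℝ (e '' T) := by
  rw [mem_span_e_image] at hx ⊢
  intro i hi
  rw [Matrix.mulVec, dotProduct]
  refine Finset.sum_eq_zero fun j _ => ?_
  by_cases hj : j ∈ S
  · rw [hX i hi j hj, zero_mul]
  · rw [hx j hj, mul_zero]

theorem bracket_mem_span_e_image {L : V7 →ₗ[ℝ] M7} (hL : ∀ x, L x ∈ hIII) {S T U : Set (Fin 7)}
    (hS : ∀ X ∈ hIII, ∀ i ∉ U, ∀ j ∈ S, X i j = 0)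
    (hT : ∀ X ∈ hIII, ∀ i ∉ U, ∀ j ∈ T, X i j = 0) {x y : V7}
    (hx : x ∈ Submodule.span ℝ (e '' S)) (hy : y ∈ Submodule.span ℝ (e '' T)) :
    (L x).mulVec y - (L y).mulVec x ∈ Submodule.span ℝ (e '' U) :=
  sub_mem (mulVec_mem_span_e_image (hT _ (hL x)) hy) (mulVec_mem_span_e_image (hS _ (hL y)) hx)

theorem stmt5 (L : V7 →ₗ[ℝ] M7) (hL : ∀ x, L x ∈ hIII)
    (bk : V7 → V7 → V7) (hbk : ∀ x y, bk x y = (L x).mulVec y - (L y).mulVec x) :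
    (∀ x ∈ Submodule.span ℝ ({e 0} : Set V7), ∀ y ∈ Submodule.span ℝ ({e 0} : Set V7),
      bk x y ∈ Submodule.span ℝ ({e 0} : Set V7)) ∧
    (∀ x ∈ Submodule.span ℝ ({e 1, e 2} : Set V7),
      ∀ y ∈ Submodule.span ℝ ({e 1, e 2} : Set V7),
      bk x y ∈ Submodule.span ℝ ({e 1, e 2} : Set V7)) ∧
    (∀ x ∈ Submodule.span ℝ ({e 0, e 1, e 2} : Set V7),
      ∀ y ∈ Submodule.span ℝ ({e 0, e 1, e 2} : Set V7),
      bk x y ∈ Submodule.span ℝ ({e 0, e 1, e 2} : Set V7)) ∧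
    (∀ x ∈ Submodule.span ℝ ({e 0, e 1, e 2, e 3} : Set V7),
      ∀ y ∈ Submodule.span ℝ ({e 0, e 1, e 2, e 3} : Set V7),
      bk x y ∈ Submodule.span ℝ ({e 0, e 1, e 2, e 3} : Set V7)) ∧
    (∀ x ∈ Submodule.span ℝ ({e 0, e 1, e 2, e 3, e 4} : Set V7),
      ∀ y ∈ Submodule.span ℝ ({e 0, e 1, e 2, e 3, e 4} : Set V7),
      bk x y ∈ Submodule.span ℝ ({e 0, e 1, e 2, e 3, e 4} : Set V7)) ∧
    (∀ x ∈ Submodule.span ℝ ({e 0, e 1, e 2, e 3} : Set V7),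
      ∀ y ∈ Submodule.span ℝ ({e 0, e 1, e 2} : Set V7),
      bk x y ∈ Submodule.span ℝ ({e 0, e 1, e 2} : Set V7)) ∧
    bk (e 0) (e 3) ∈ Submodule.span ℝ ({e 0} : Set V7) := by
  have h0 : ∀ X ∈ hIII, ∀ i ∉ ({0} : Set (Fin 7)), ∀ j ∈ ({0, 3} : Set (Fin 7)), X i j = 0 := by
    rintro _ ⟨A, v, y, rfl⟩ i hi j hj
    simp only [Set.mem_insert_iff, Set.mem_singleton_iff] at hi hj
    rcases hj with rfl | rfl <;> fin_cases i <;>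
      first | exact absurd hi (by decide) | simp [h3, hmat]
  have h12 : ∀ X ∈ hIII, ∀ i ∉ ({1, 2} : Set (Fin 7)), ∀ j ∈ ({1, 2} : Set (Fin 7)),
      X i j = 0 := by
    rintro _ ⟨A, v, y, rfl⟩ i hi j hj
    simp only [Set.mem_insert_iff, Set.mem_singleton_iff] at hi hj
    rcases hj with rfl | rfl <;> fin_cases i <;>
      first | exact absurd hi (by decide) | simp [h3, hmat]
  have h01234 : ∀ X ∈ hIII, ∀ i ∉ ({0, 1, 2, 3, 4} : Set (Fin 7)),
      ∀ j ∈ ({0, 1, 2, 3, 4} : Set (Fin 7)), X i j = 0 := by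
    rintro _ ⟨A, v, y, rfl⟩ i hi j hj
    simp only [Set.mem_insert_iff, Set.mem_singleton_iff] at hi hj
    rcases hj with rfl | rfl | rfl | rfl | rfl <;> fin_cases i <;>
      first | exact absurd hi (by decide) | simp [h3, hmat]
  have h012' : ∀ X ∈ hIII, ∀ i ∉ ({0, 1, 2} : Set (Fin 7)),
      ∀ j ∈ ({0, 1, 2, 3} : Set (Fin 7)), X i j = 0 := by
    intro X hX i hi j hj
    have hj' : j ∈ ({0, 3} : Set (Fin 7)) ∨ j ∈ ({1, 2} : Set (Fin 7)) := by
      simp only [Set.mem_insert_iff, Set.mem_singleton_iff] at hj ⊢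
      tauto
    rcases hj' with hj' | hj'
    · exact h0 X hX i (fun h => hi (by simp_all)) j hj'
    · exact h12 X hX i (fun h => hi (Or.inr h)) j hj'
  have h0' : ∀ X ∈ hIII, ∀ i ∉ ({0} : Set (Fin 7)), ∀ j ∈ ({0} : Set (Fin 7)), X i j = 0 :=
    fun X hX i hi j hj => h0 X hX i hi j (Or.inl hj)
  have h012 : ∀ X ∈ hIII, ∀ i ∉ ({0, 1, 2} : Set (Fin 7)),
      ∀ j ∈ ({0, 1, 2} : Set (Fin 7)), X i j = 0 :=
    fun X hX i hi j hj => h012' X hX i hi j (by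
      simp only [Set.mem_insert_iff, Set.mem_singleton_iff] at hj ⊢
      tauto)
  have h0123 : ∀ X ∈ hIII, ∀ i ∉ ({0, 1, 2, 3} : Set (Fin 7)),
      ∀ j ∈ ({0, 1, 2, 3} : Set (Fin 7)), X i j = 0 :=
    fun X hX i hi => h012' X hX i fun h => hi (by
      simp only [Set.mem_insert_iff, Set.mem_singleton_iff] at h ⊢
      tauto)
  have key {S T U : Set (Fin 7)} (hS : ∀ X ∈ hIII, ∀ i ∉ U, ∀ j ∈ S, X i j = 0)
      (hT : ∀ X ∈ hIII, ∀ i ∉ U, ∀ j ∈ T, X i j = 0) :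
      ∀ x ∈ Submodule.span ℝ (e '' S), ∀ y ∈ Submodule.span ℝ (e '' T),
        bk x y ∈ Submodule.span ℝ (e '' U) := fun x hx y hy => by
    rw [hbk]
    exact bracket_mem_span_e_image hL hS hT hx hy
  have hmem : ∀ i ∈ ({0, 3} : Set (Fin 7)), e i ∈ Submodule.span ℝ (e '' {0, 3}) :=
    fun i hi => Submodule.subset_span (Set.mem_image_of_mem e hi)
  simp only [← Set.image_singleton (f := e), ← Set.image_insert_eq (f := e)]
  exact ⟨key h0' h0', key h12 h12, key h012 h012, key h0123 h0123, key h01234 h01234,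
    key h012' h012,
    key h0 h0 _ (hmem 0 (by simp)) _ (hmem 3 (by simp))⟩
end
end

section
/- Suppose [·,·] is a Lie bracket on ℝ^7 and Λ : ℝ^7 → 𝔤𝔩(7,ℝ) is a linear map with Λ(x)y − Λ(y)x = [x,y] and Λ(x) ∈ 𝔥^III for all x,y ∈ ℝ^7. Write Λ(e_i) = h(A_i, v_i, (y_{i1},y_{i2})). If v_i = 0 for all i = 1,…,7, then the infinitesimal holonomy 𝔥 is decomposable (indeed Λ(x)e_4 = 0 for all x, so ℝ·e_4 is a nondegenerate 𝔥-invariant line). -/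
open Matrix

noncomputable section

/-- The curvature `R(x,y) = Λ(x)Λ(y) − Λ(y)Λ(x) − Λ([x,y])`. -/
def curv (L : V7 →ₗ[ℝ] M7) (bk : V7 → V7 → V7) (x y : V7) : M7 :=
  L x * L y - L y * L x - L (bk x y)

/-- The infinitesimal holonomy: the smallest linear subspace of `𝔤𝔩(7,ℝ)` containing
all `R(x,y)` and stable under bracketing with all `Λ(z)`. -/
def infHol (L : V7 →ₗ[ℝ] M7) (bk : V7 → V7 → V7) : Submodule ℝ M7 :=
  sInf {H : Submodule ℝ M7 | (∀ x y, curv L bk x y ∈ H) ∧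
    ∀ z : V7, ∀ X ∈ H, L z * X - X * L z ∈ H}

/-- An element of `𝔥^III` with vanishing `v`-component kills `e_4`. -/
theorem mulVec_e_three_of_mem_hIII {X : M7} (hX : X ∈ hIII) (hv : proV X = 0) :
    X.mulVec (e 3) = 0 := by
  obtain ⟨A, v, y, rfl⟩ := hX
  obtain rfl : v = 0 := by simpa [proV, h3, hmat] using hv
  ext i
  fin_cases i <;> simp [e, h3, hmat]

/-- The infinitesimal holonomy kills every vector killed by the image of `Λ`. -/
theorem mulVec_eq_zero_of_mem_infHol {L : V7 →ₗ[ℝ] M7} {bk : V7 → V7 → V7} {w : V7}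
    (hw : ∀ x, (L x).mulVec w = 0) {X : M7} (hX : X ∈ infHol L bk) : X.mulVec w = 0 := by
  let K : Submodule ℝ M7 :=
    { carrier := {Y | Y.mulVec w = 0}
      add_mem' := fun {Y Z} (hY : Y.mulVec w = 0) (hZ : Z.mulVec w = 0) => by
        simp [Matrix.add_mulVec, hY, hZ]
      zero_mem' := Matrix.zero_mulVec w
      smul_mem' := fun c Y (hY : Y.mulVec w = 0) => by simp [Matrix.smul_mulVec, hY] }
  have hK : infHol L bk ≤ K := by
    refine sInf_le ⟨fun x y => ?_, fun z Y hY => ?_⟩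
    · change (curv L bk x y).mulVec w = 0
      simp [curv, Matrix.sub_mulVec, ← Matrix.mulVec_mulVec, hw]
    · have hY' : Y.mulVec w = 0 := hY
      change (L z * Y - Y * L z).mulVec w = 0
      simp [Matrix.sub_mulVec, ← Matrix.mulVec_mulVec, hw, hY']
  exact hK hX

/-- A set of matrices killing the non-null vector `e_4` is decomposable. -/
theorem decomposable_of_mulVec_e_three {H : Set M7} (hH : ∀ X ∈ H, X.mulVec (e 3) = 0) :
    Decomposable H := by
  refine ⟨Submodule.span ℝ {e 3}, ?_, ?_, ?_, ?_⟩
  · simp [e]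
  · intro h
    have h0 : e 0 ∈ Submodule.span ℝ {e 3} := h ▸ Submodule.mem_top
    obtain ⟨c, hc⟩ := Submodule.mem_span_singleton.1 h0
    simpa [e] using congrFun hc 0
  · intro X hX w hw
    obtain ⟨c, rfl⟩ := Submodule.mem_span_singleton.1 hw
    simp [Matrix.mulVec_smul, hH X hX]
  · intro w hw h
    obtain ⟨c, rfl⟩ := Submodule.mem_span_singleton.1 hw
    have hc : c = 0 := by
      simpa [ip, e] using h (e 3) (Submodule.mem_span_singleton_self _)
    simp [hc]

theorem stmt7 (bk : V7 → V7 → V7) (L : V7 →ₗ[ℝ] M7)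
    (hbk : ∀ x y : V7, (L x).mulVec y - (L y).mulVec x = bk x y)
    (halt : ∀ x : V7, bk x x = 0)
    (hjac : ∀ x y z : V7, bk (bk x y) z + bk (bk y z) x + bk (bk z x) y = 0)
    (hL : ∀ x, L x ∈ hIII)
    (hv : ∀ i : Fin 7, proV (L (e i)) = 0) :
    (∀ x : V7, (L x).mulVec (e 3) = 0) ∧ Decomposable (infHol L bk : Set M7) := by
  have hproV (x : V7) : proV (L x) = 0 := by
    rw [← Finset.univ_sum_single x, map_sum]
    simp only [proV, Matrix.sum_apply]
    refine Finset.sum_eq_zero fun i _ => ?_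
    have hi : L (Pi.single i (x i)) = x i • L (e i) := by
      rw [← map_smul, e, ← Pi.single_smul, smul_eq_mul, mul_one]
    have hvi : L (e i) 1 6 = 0 := hv i
    simp [hi, hvi]
  have hkill (x : V7) : (L x).mulVec (e 3) = 0 :=
    mulVec_e_three_of_mem_hIII (hL x) (hproV x)
  exact ⟨hkill, decomposable_of_mulVec_e_three fun X hX => mulVec_eq_zero_of_mem_infHol hkill hX⟩
end
end
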